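/- Let 𝒜 be the universal alphabet of atoms and Γ1, Γ2 propositional theories over L ⊆ 𝒜. Setting A⁺(a) = A⁻(a) = ∅, A⁺(s) = A⁻(s) = 𝒜, A⁺(u) = 𝒜 and A⁻(u) = ∅, for each e ∈ {a, s, u} the following are equivalent: (1) Γ1 ≡_e Γ2; (2) Γ1 ≡^{A⁺(e)}_{A⁻(e)} Γ2 (relativized hyperequivalence wrt. A⁺(e) and A⁻(e)). -/

import Mathlib

/-- Propositional formulas over atoms of type `α`. -/
inductive PForm (α : Type) : Type where
  | atom : α → PForm α
  | bot  : PForm α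
  | conj : PForm α → PForm α → PForm α
  | disj : PForm α → PForm α → PForm α
  | impl : PForm α → PForm α → PForm α

namespace PForm

variable {α : Type}

/-- Classical satisfaction by a set of atoms. -/
def clSat (Y : Set α) : PForm α → Prop
  | atom a   => a ∈ Y
  | bot      => False
  | conj φ ψ => clSat Y φ ∧ clSat Y ψ
  | disj φ ψ => clSat Y φ ∨ clSat Y ψ
  | impl φ ψ => clSat Y φ → clSat Y ψ

/-- HT-satisfaction by a pair (X,Y) of sets of atoms. -/
def htSat (X Y : Set α) : PForm α → Prop
  | atom a   => a ∈ X
  | bot      => False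
  | conj φ ψ => htSat X Y φ ∧ htSat X Y ψ
  | disj φ ψ => htSat X Y φ ∨ htSat X Y ψ
  | impl φ ψ => (htSat X Y φ → htSat X Y ψ) ∧ (clSat Y φ → clSat Y ψ)

/-- Factual formulas: built from ∧, ∨, ⊥ and negations φ → ⊥ only. -/
def Factual : PForm α → Prop
  | atom _   => True
  | bot      => True
  | conj φ ψ => Factual φ ∧ Factual ψ
  | disj φ ψ => Factual φ ∧ Factual ψ
  | impl φ ψ => Factual φ ∧ ψ = PForm.bot

/-- All atoms of the formula belong to `L`. -/
def atomsIn (L : Set α) : PForm α → Prop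
  | atom a   => a ∈ L
  | bot      => True
  | conj φ ψ => atomsIn L φ ∧ atomsIn L ψ
  | disj φ ψ => atomsIn L φ ∧ atomsIn L ψ
  | impl φ ψ => atomsIn L φ ∧ atomsIn L ψ

end PForm

abbrev Theory (α : Type) := Set (PForm α)

variable {α : Type}

/-- An HT-interpretation (X,Y) satisfies a theory. -/
def htSatT (X Y : Set α) (Γ : Theory α) : Prop := ∀ φ ∈ Γ, PForm.htSat X Y φ

/-- Classical satisfaction of a theory. -/
def clSatT (Y : Set α) (Γ : Theory α) : Prop := ∀ φ ∈ Γ, PForm.clSat Y φ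

/-- A factual theory. -/
def FactualT (Γ : Theory α) : Prop := ∀ φ ∈ Γ, PForm.Factual φ

/-- Y is an answer set of Γ, i.e. (Y,Y) is an equilibrium model of Γ. -/
def IsAnswerSet (Γ : Theory α) (Y : Set α) : Prop :=
  htSatT Y Y Γ ∧ ∀ X, X ⊂ Y → ¬ htSatT X Y Γ

/-- Answer-set equivalence. -/
def AnswerEquiv (Γ₁ Γ₂ : Theory α) : Prop :=
  ∀ Y : Set α, IsAnswerSet Γ₁ Y ↔ IsAnswerSet Γ₂ Y

/-- Classical equivalence. -/
def ClassEquiv (Γ₁ Γ₂ : Theory α) : Prop :=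
  ∀ Y : Set α, clSatT Y Γ₁ ↔ clSatT Y Γ₂

/-- Strong equivalence. -/
def StrongEquiv (Γ₁ Γ₂ : Theory α) : Prop :=
  ∀ Γ : Theory α, AnswerEquiv (Γ₁ ∪ Γ) (Γ₂ ∪ Γ)

/-- Uniform equivalence (wrt factual theories). -/
def UnifEquiv (Γ₁ Γ₂ : Theory α) : Prop :=
  ∀ Γ : Theory α, FactualT Γ → AnswerEquiv (Γ₁ ∪ Γ) (Γ₂ ∪ Γ)

/-- The set of HT-countermodels of Γ. -/
def Cs (Γ : Theory α) : Set (Set α × Set α) :=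
  {p | p.1 ⊆ p.2 ∧ ¬ htSatT p.1 p.2 Γ}

/-- The set of equivalence interpretations of Γ: total HT-models and here-countermodels. -/
def Es (Γ : Theory α) : Set (Set α × Set α) :=
  {p | p.1 ⊆ p.2 ∧
    ((p.1 = p.2 ∧ htSatT p.1 p.2 Γ) ∨ (¬ htSatT p.1 p.2 Γ ∧ clSatT p.2 Γ))}

/-- (X,Y) is there-closed in a set S of HT-interpretations. -/
def ThereClosedIn (S : Set (Set α × Set α)) (X Y : Set α) : Prop :=
  (Y, Y) ∉ S ∧ ∀ X', X ⊆ X' → X' ⊂ Y → (X', Y) ∈ S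

/-- (X,Y) is closed in a set S of HT-interpretations. -/
def ClosedIn (S : Set (Set α × Set α)) (X Y : Set α) : Prop :=
  ∀ X', X ⊆ X' → X' ⊆ Y → (X', Y) ∈ S

/-- C_u(Γ): there-closed HT-interpretations wrt the countermodels of Γ. -/
def Cu (Γ : Theory α) : Set (Set α × Set α) :=
  {p | p.1 ⊆ p.2 ∧ ThereClosedIn (Cs Γ) p.1 p.2}


/-- Polarity-correct occurrence of atoms: `APol Ap An true φ` states that the formula φ,
itself occurring positively, has all its positively occurring atoms in `Ap` and all its
negatively occurring atoms in `An` (atoms in antecedents of implications occur negatively,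
atoms in consequents occur positively; in a negatively occurring implication — e.g. the
antecedent φ₁ of (φ₁→φ₂)→φ₃ — both components additionally occur with both polarities). -/
def APol (Ap An : Set α) : Bool → PForm α → Prop
  | p, .atom a => if p then a ∈ Ap else a ∈ An
  | _, .bot => True
  | p, .conj φ ψ => APol Ap An p φ ∧ APol Ap An p ψ
  | p, .disj φ ψ => APol Ap An p φ ∧ APol Ap An p ψ
  | true, .impl φ ψ => APol Ap An false φ ∧ APol Ap An true ψ
  | false, .impl φ ψ =>
      (APol Ap An false φ ∧ APol Ap An true φ) ∧ (APol Ap An true ψ ∧ APol Ap An false ψ)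

/-- An A⁺-A⁻-theory. -/
def IsAATheory (Ap An : Set α) (Γ : Theory α) : Prop :=
  ∀ φ ∈ Γ, APol Ap An true φ

/-- An extended A⁺-A⁻-theory: additionally factual formulas over A⁺ are permitted. -/
def IsExtAATheory (Ap An : Set α) (Γ : Theory α) : Prop :=
  ∀ φ ∈ Γ, APol Ap An true φ ∨ (PForm.Factual φ ∧ PForm.atomsIn Ap φ)

/-- Relativized hyperequivalence wrt A⁺ and A⁻. -/
def HyperEquiv (Ap An : Set α) (Γ₁ Γ₂ : Theory α) : Prop :=
  ∀ Γ : Theory α, IsAATheory Ap An Γ → AnswerEquiv (Γ₁ ∪ Γ) (Γ₂ ∪ Γ)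

/-- (Y,Y) is A⁺-total: (Y ∩ A⁺, Y) is closed in E_s(Γ). -/
def ApTotal (Ap : Set α) (Γ : Theory α) (Y : Set α) : Prop :=
  ∀ X', Y ∩ Ap ⊆ X' → X' ⊆ Y → (X', Y) ∈ Es Γ

/-- (X,Y) is A⁺-closed in E_s(Γ). -/
def ApClosed (Ap An : Set α) (Γ : Theory α) (X Y : Set α) : Prop :=
  ∀ X', X' ⊆ Y → X ∩ Ap ⊆ X' ∩ Ap → X' ∩ An ⊆ X ∩ An → (X', Y) ∈ Es Γ

/-- E^{A⁺}_{A⁻}(Γ): the HT-hyperequivalence interpretations of Γ wrt A⁺ and A⁻. -/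
def Eh (Ap An : Set α) (Γ : Theory α) : Set (Set α × Set α) :=
  {p | p.1 ⊆ p.2 ∧ ApTotal Ap Γ p.2 ∧
    ∃ X', X' ⊆ p.2 ∧ p.1 = X' ∩ (Ap ∪ An) ∧ ApClosed Ap An Γ X' p.2}

theorem ht_pers {X Y : Set α} (h : X ⊆ Y) (φ : PForm α) :
    PForm.htSat X Y φ → PForm.clSat Y φ := by
  induction φ with
  | atom a => exact fun ha => h ha
  | bot => exact id
  | conj φ ψ ih1 ih2 => exact fun k => ⟨ih1 k.1, ih2 k.2⟩
  | disj φ ψ ih1 ih2 => exact fun k => k.imp ih1 ih2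
  | impl φ ψ ih1 ih2 => exact fun k => k.2

theorem ht_neg {Ap : Set α} (X Y : Set α) (φ : PForm α) (h : APol Ap ∅ false φ) :
    PForm.htSat X Y φ ↔ PForm.clSat Y φ := by
  induction φ with
  | atom a => simp [APol] at h
  | bot => exact Iff.rfl
  | conj φ ψ ih1 ih2 =>
    simp only [APol] at h
    simp only [PForm.htSat, PForm.clSat, ih1 h.1, ih2 h.2]
  | disj φ ψ ih1 ih2 =>
    simp only [APol] at h
    simp only [PForm.htSat, PForm.clSat, ih1 h.1, ih2 h.2]
  | impl φ ψ ih1 ih2 =>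
    simp only [APol] at h
    simp only [PForm.htSat, PForm.clSat, ih1 h.1.1, ih2 h.2.2, and_self]

theorem ht_closed (X Y : Set α) (φ : PForm α) (h : APol ∅ ∅ true φ) :
    PForm.htSat X Y φ ↔ PForm.clSat Y φ := by
  induction φ with
  | atom a => simp [APol] at h
  | bot => exact Iff.rfl
  | conj φ ψ ih1 ih2 =>
    simp only [APol] at h
    simp only [PForm.htSat, PForm.clSat, ih1 h.1, ih2 h.2]
  | disj φ ψ ih1 ih2 =>
    simp only [APol] at h
    simp only [PForm.htSat, PForm.clSat, ih1 h.1, ih2 h.2]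
  | impl φ ψ ih1 ih2 =>
    simp only [APol] at h
    simp only [PForm.htSat, PForm.clSat, ht_neg X Y φ h.1, ih2 h.2, and_self]

open Classical in
noncomputable def redF (Y : Set α) : PForm α → PForm α
  | .atom a => .atom a
  | .bot => .bot
  | .conj φ ψ => .conj (redF Y φ) (redF Y ψ)
  | .disj φ ψ => .disj (redF Y φ) (redF Y ψ)
  | .impl φ ψ => if PForm.clSat Y φ then redF Y ψ else .impl .bot .bot

theorem redF_factual (Y : Set α) (φ : PForm α) : PForm.Factual (redF Y φ) := by
  induction φ with
  | atom a => trivial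
  | bot => trivial
  | conj φ ψ ih1 ih2 => exact ⟨ih1, ih2⟩
  | disj φ ψ ih1 ih2 => exact ⟨ih1, ih2⟩
  | impl φ ψ ih1 ih2 =>
    simp only [redF]
    split_ifs
    · exact ih2
    · exact ⟨trivial, rfl⟩

theorem redF_apol (Y : Set α) (φ : PForm α) : APol Set.univ ∅ true (redF Y φ) := by
  induction φ with
  | atom a => simp [redF, APol]
  | bot => simp [redF, APol]
  | conj φ ψ ih1 ih2 => simp [redF, APol, ih1, ih2]
  | disj φ ψ ih1 ih2 => simp [redF, APol, ih1, ih2]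
  | impl φ ψ ih1 ih2 =>
    simp only [redF]
    split_ifs
    · exact ih2
    · simp [APol]

theorem redF_sat {X Y : Set α} (hXY : X ⊆ Y) (φ : PForm α)
    (h : PForm.Factual φ ∨ APol Set.univ ∅ true φ) :
    PForm.htSat X Y (redF Y φ) ↔ PForm.htSat X Y φ := by
  induction φ with
  | atom a => exact Iff.rfl
  | bot => exact Iff.rfl
  | conj φ ψ ih1 ih2 =>
    simp only [APol, PForm.Factual] at h
    simp only [redF, PForm.htSat, ih1 (h.imp And.left And.left), ih2 (h.imp And.right And.right)]
  | disj φ ψ ih1 ih2 =>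
    simp only [APol, PForm.Factual] at h
    simp only [redF, PForm.htSat, ih1 (h.imp And.left And.left), ih2 (h.imp And.right And.right)]
  | impl φ ψ ih1 ih2 =>
    simp only [APol, PForm.Factual] at h
    have p1 := ht_pers hXY φ
    have p2 := ht_pers hXY ψ
    simp only [redF]
    rcases h with ⟨_, rfl⟩ | ⟨h1, h2⟩
    · split_ifs with hc
      · simp [redF, PForm.htSat, PForm.clSat, hc]
      · simp only [PForm.htSat, PForm.clSat]
        tauto
    · have := ht_neg X Y φ h1
      split_ifs with hc
      · rw [ih2 (Or.inr h2)]
        simp only [PForm.htSat]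
        tauto
      · simp only [PForm.htSat, PForm.clSat]
        tauto

theorem htSatT_union (X Y : Set α) (Γ Δ : Theory α) :
    htSatT X Y (Γ ∪ Δ) ↔ htSatT X Y Γ ∧ htSatT X Y Δ := by
  simp only [htSatT, Set.mem_union, or_imp, forall_and]

theorem as_red (Y : Set α) (Γ Δ : Theory α)
    (h : ∀ φ ∈ Δ, PForm.Factual φ ∨ APol Set.univ ∅ true φ) :
    IsAnswerSet (Γ ∪ Δ) Y ↔ IsAnswerSet (Γ ∪ redF Y '' Δ) Y := by
  have key : ∀ X, X ⊆ Y → (htSatT X Y (Γ ∪ Δ) ↔ htSatT X Y (Γ ∪ redF Y '' Δ)) := by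
    intro X hX
    rw [htSatT_union, htSatT_union]
    refine and_congr_right fun _ => ?_
    simp only [htSatT, Set.forall_mem_image]
    exact forall₂_congr fun φ hφ => (redF_sat hX φ (h φ hφ)).symm
  unfold IsAnswerSet
  rw [key Y subset_rfl]
  exact and_congr_right fun _ => forall₂_congr fun X hX => not_congr (key X hX.subset)

theorem apol_univ (p : Bool) (φ : PForm α) : APol Set.univ Set.univ p φ := by
  induction φ generalizing p with
  | atom a => simp [APol]
  | bot => simp [APol]
  | conj φ ψ ih1 ih2 => simp [APol, ih1, ih2]
  | disj φ ψ ih1 ih2 => simp [APol, ih1, ih2]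
  | impl φ ψ ih1 ih2 => cases p <;> simp [APol, ih1, ih2]

theorem as_closed (Y : Set α) (Γ Δ : Theory α) (h : IsAATheory ∅ ∅ Δ) :
    IsAnswerSet (Γ ∪ Δ) Y ↔ IsAnswerSet Γ Y ∧ clSatT Y Δ := by
  have key : ∀ X, htSatT X Y Δ ↔ clSatT Y Δ := fun X =>
    forall₂_congr fun φ hφ => ht_closed X Y φ (h φ hφ)
  simp only [IsAnswerSet, htSatT_union, key]
  by_cases hc : clSatT Y Δ <;> simp [hc]

/-- With the whole type α as the universal alphabet 𝒜, L ⊆ 𝒜, and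
A⁺(a)=A⁻(a)=∅, A⁺(s)=A⁻(s)=𝒜, A⁺(u)=𝒜, A⁻(u)=∅, for each e ∈ {a,s,u}:
Γ₁ ≡ₑ Γ₂ iff Γ₁ ≡^{A⁺(e)}_{A⁻(e)} Γ₂. -/
theorem equivalences_as_relativized_hyperequivalence (L : Set α) (Γ₁ Γ₂ : Theory α)
    (h₁ : ∀ φ ∈ Γ₁, PForm.atomsIn L φ) (h₂ : ∀ φ ∈ Γ₂, PForm.atomsIn L φ) :
    (AnswerEquiv Γ₁ Γ₂ ↔ HyperEquiv (∅ : Set α) (∅ : Set α) Γ₁ Γ₂) ∧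
    (StrongEquiv Γ₁ Γ₂ ↔ HyperEquiv (Set.univ : Set α) (Set.univ : Set α) Γ₁ Γ₂) ∧
    (UnifEquiv Γ₁ Γ₂ ↔ HyperEquiv (Set.univ : Set α) (∅ : Set α) Γ₁ Γ₂) := by
  constructor
  · constructor
    · intro h Δ hΔ Y
      rw [as_closed Y _ _ hΔ, as_closed Y _ _ hΔ, h Y]
    · intro h
      have := h ∅ (fun φ hφ => hφ.elim)
      simpa using this
  constructor
  · exact ⟨fun h Δ _ => h Δ, fun h Δ => h Δ fun φ _ => apol_univ true φ⟩
  constructor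
  · intro h Δ hΔ Y
    rw [as_red Y _ _ fun φ hφ => Or.inr (hΔ φ hφ), as_red Y _ _ fun φ hφ => Or.inr (hΔ φ hφ)]
    refine h _ ?_ Y
    rintro _ ⟨φ, _, rfl⟩
    exact redF_factual Y φ
  · intro h Δ hΔ Y
    rw [as_red Y _ _ fun φ hφ => Or.inl (hΔ φ hφ), as_red Y _ _ fun φ hφ => Or.inl (hΔ φ hφ)]
    refine h _ ?_ Y
    rintro _ ⟨φ, _, rfl⟩
    exact redF_apol Y φ
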